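/- Let 1 < s < 2 and β > 0, and for each N ≥ 3 let A = {0, 1, …, ⌊N/2⌋ − 1} ⊆ ZMod N. There exists a constant c = c(s,β) > 0, independent of N, such that ∑_{x ∈ A} ∑_{y ∉ A} ( 1 − exp(−β‖x−y‖^(−s)) ) ≤ c · N^(2−s), where ‖x−y‖ = min(|x−y|, N−|x−y|) is the graph distance on the N-cycle (using representatives in {0,…,N−1}). -/

import Mathlib

open MeasureTheory Filter

noncomputable section

/-- Cycle distance on `ZMod N`: `‖x − y‖ = min(|x−y|, N−|x−y|)`, computed via the
representatives in `{0, …, N−1}`. -/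
def cycleDist (N : ℕ) (x y : ZMod N) : ℕ := min (x - y).val (y - x).val

/-- The probability `1 − exp(−β ‖x−y‖^{−s})` of a long-range edge between the two endpoints
of an unordered pair of vertices. -/
def edgeProb (N : ℕ) (s β : ℝ) : Sym2 (ZMod N) → ℝ :=
  Sym2.lift ⟨fun x y => 1 - Real.exp (-β * (cycleDist N x y : ℝ) ^ (-s)),
    fun x y => by have h : cycleDist N x y = cycleDist N y x := min_comm _ _; simp [h]⟩

/-- The Bernoulli measure on `Bool` with success probability `p`. -/
def bernoulliMeasure (p : ℝ) : Measure Bool :=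
  ENNReal.ofReal (1 - p) • Measure.dirac false + ENNReal.ofReal p • Measure.dirac true

/-- The arc `A = {0, 1, …, ⌊N/2⌋ − 1}` in `ZMod N`. -/
def arcA (N : ℕ) [NeZero N] : Finset (ZMod N) := Finset.univ.filter fun x => x.val < N / 2

end

open Finset in
/-- A sum of a function of `y - x` over pairs crossing the cut `(A, Aᶜ)`, arranged by the
value of `y - x`. -/
lemma sum_sum_compl_sub {G M : Type*} [AddCommGroup G] [Fintype G] [DecidableEq G]
    [AddCommMonoid M] (A : Finset G) (f : G → M) :
    ∑ x ∈ A, ∑ y ∈ Aᶜ, f (y - x) = ∑ k, #{x ∈ A | x + k ∉ A} • f k := by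
  have inner (x : G) : ∑ y ∈ Aᶜ, f (y - x) = ∑ k, if x + k ∉ A then f k else 0 := by
    rw [← Equiv.sum_comp (Equiv.subRight x) fun k => if x + k ∉ A then f k else 0]
    simp only [Equiv.subRight_apply, add_sub_cancel, ← mem_compl, ← sum_filter, filter_univ_mem]
  simp_rw [inner]
  rw [sum_comm]
  refine sum_congr rfl fun k _ => ?_
  rw [← sum_filter, sum_const]

open Finset in
/-- At most `k.val` points of the arc leave it under translation by `k`. -/
lemma card_arcA_add_notMem_le_val (N : ℕ) [NeZero N] (k : ZMod N) :
    #{x ∈ arcA N | x + k ∉ arcA N} ≤ k.val := by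
  have h : #{x ∈ arcA N | x + k ∉ arcA N} ≤ #(Ico (N / 2 - k.val) (N / 2)) := by
    refine card_le_card_of_injOn ZMod.val (fun x hx => ?_) (ZMod.val_injective N).injOn
    simp only [arcA, coe_filter, mem_filter, mem_univ, true_and, Set.mem_ofPred_eq, not_lt,
      coe_Ico, Set.mem_Ico] at hx ⊢
    have := ZMod.val_add_le x k
    omega
  rw [Nat.card_Ico] at h
  omega

open Finset in
/-- At most `(-k).val` points of the arc leave it under translation by `k`. -/
lemma card_arcA_add_notMem_le_val_neg (N : ℕ) [NeZero N] (k : ZMod N) :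
    #{x ∈ arcA N | x + k ∉ arcA N} ≤ (-k).val := by
  have h : #{x ∈ arcA N | x + k ∉ arcA N} ≤ #(range (-k).val) := by
    refine card_le_card_of_injOn ZMod.val (fun x hx => ?_) (ZMod.val_injective N).injOn
    simp only [arcA, coe_filter, mem_filter, mem_univ, true_and, Set.mem_ofPred_eq, not_lt,
      coe_range, Set.mem_Iio] at hx ⊢
    by_contra! hle
    have := ZMod.val_sub hle
    rw [sub_neg_eq_add] at this
    omega
  rwa [card_range] at h

lemma mul_rpow_sub_one_le_rpow_succ_sub_rpow {p : ℝ} (hp0 : 0 ≤ p) (hp1 : p ≤ 1) (n : ℕ) :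
    p * ((n + 1 : ℕ) : ℝ) ^ (p - 1) ≤ ((n + 1 : ℕ) : ℝ) ^ p - (n : ℝ) ^ p := by
  have hpos : (0 : ℝ) < (n + 1 : ℕ) := by positivity
  have hle : -1 ≤ -(((n + 1 : ℕ) : ℝ))⁻¹ := by
    rw [neg_le_neg_iff]
    exact inv_le_one_of_one_le₀ (by simp)
  have hbern := rpow_one_add_le_one_add_mul_self hle hp0 hp1
  have hn : (n : ℝ) = ((n + 1 : ℕ) : ℝ) * (1 + -(((n + 1 : ℕ) : ℝ))⁻¹) := by
    field_simp
    push_cast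
    ring
  have hmul : (n : ℝ) ^ p ≤ ((n + 1 : ℕ) : ℝ) ^ p * (1 + p * -(((n + 1 : ℕ) : ℝ))⁻¹) := by
    conv_lhs => rw [hn]
    rw [Real.mul_rpow hpos.le (by linarith)]
    gcongr
  rw [Real.rpow_sub_one hpos.ne', div_eq_mul_inv]
  linarith

/-- Comparison of `∑ k ^ (1 - s)` with the integral of `x ^ (1 - s)`. -/
lemma sum_range_mul_rpow_neg_le {s : ℝ} (hs1 : 1 ≤ s) (hs2 : s < 2) (N : ℕ) :
    ∑ k ∈ Finset.range N, (k : ℝ) * (k : ℝ) ^ (-s) ≤ (N : ℝ) ^ (2 - s) / (2 - s) := by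
  have hp : 0 < 2 - s := by linarith
  have succ_bound (n : ℕ) :
      ∑ k ∈ Finset.range (n + 1), (k : ℝ) * (k : ℝ) ^ (-s) ≤ (n : ℝ) ^ (2 - s) / (2 - s) := by
    induction n with
    | zero => simp [Real.zero_rpow hp.ne']
    | succ n ih =>
      rw [Finset.sum_range_succ]
      have hstep := mul_rpow_sub_one_le_rpow_succ_sub_rpow hp.le (by linarith) n
      have hpos : (0 : ℝ) < (n + 1 : ℕ) := by positivity
      have hterm : ((n + 1 : ℕ) : ℝ) * ((n + 1 : ℕ) : ℝ) ^ (-s)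
          = ((n + 1 : ℕ) : ℝ) ^ (2 - s - 1) := by
        rw [show 2 - s - 1 = 1 + -s by ring, Real.rpow_add hpos, Real.rpow_one]
      rw [le_div_iff₀ hp] at ih ⊢
      rw [hterm]
      linarith
  refine le_trans ?_ (succ_bound N)
  rw [Finset.sum_range_succ]
  exact le_add_of_nonneg_right (by positivity)

lemma ZMod.sum_comp_val {M : Type*} [AddCommMonoid M] (N : ℕ) [NeZero N] (f : ℕ → M) :
    ∑ k : ZMod N, f k.val = ∑ j ∈ Finset.range N, f j := by
  refine Finset.sum_nbij ZMod.val (fun k _ => Finset.mem_range.2 k.val_lt)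
    (ZMod.val_injective N).injOn (fun j hj => ?_) fun _ _ => rfl
  exact ⟨(j : ZMod N), by simp, ZMod.val_cast_of_lt (by simpa using hj)⟩

/-- The sum of `‖x - y‖ ^ (-s)` over pairs crossing the cut between the arc and its complement. -/
lemma sum_arcA_cycleDist_rpow_le {s : ℝ} (hs1 : 1 ≤ s) (hs2 : s < 2) (N : ℕ) [NeZero N] :
    ∑ x ∈ arcA N, ∑ y ∈ (arcA N)ᶜ, (cycleDist N x y : ℝ) ^ (-s) ≤
      2 / (2 - s) * (N : ℝ) ^ (2 - s) := by
  let g : ℕ → ℝ := fun j => (j : ℝ) * (j : ℝ) ^ (-s)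
  have hg (j : ℕ) : 0 ≤ g j := by positivity
  have hsum : ∑ k : ZMod N, g k.val ≤ (N : ℝ) ^ (2 - s) / (2 - s) := by
    rw [ZMod.sum_comp_val N g]
    exact sum_range_mul_rpow_neg_le hs1 hs2 N
  have hsum_neg : ∑ k : ZMod N, g (-k).val = ∑ k : ZMod N, g k.val :=
    Equiv.sum_comp (Equiv.neg (ZMod N)) fun k => g k.val
  have hdist (x y : ZMod N) : cycleDist N x y = min (-(y - x)).val (y - x).val := by
    rw [neg_sub, cycleDist]
  simp_rw [hdist]
  rw [sum_sum_compl_sub (arcA N) fun k : ZMod N => ((min (-k).val k.val : ℕ) : ℝ) ^ (-s)]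
  calc
    _ ≤ ∑ k : ZMod N, (g (-k).val + g k.val) := by
      refine Finset.sum_le_sum fun k _ => ?_
      have hcard := le_min (card_arcA_add_notMem_le_val_neg N k) (card_arcA_add_notMem_le_val N k)
      have hmin : g (min (-k).val k.val) ≤ g (-k).val + g k.val := by
        rcases min_choice (-k).val k.val with h | h <;> rw [h] <;>
          linarith [hg (-k).val, hg k.val]
      refine le_trans ?_ hmin
      rw [nsmul_eq_mul]
      exact mul_le_mul_of_nonneg_right (Nat.cast_le.2 hcard) (by positivity)
    _ ≤ 2 / (2 - s) * (N : ℝ) ^ (2 - s) := by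
      rw [Finset.sum_add_distrib, hsum_neg]
      calc
        _ ≤ (N : ℝ) ^ (2 - s) / (2 - s) + (N : ℝ) ^ (2 - s) / (2 - s) := add_le_add hsum hsum
        _ = _ := by ring

/-- For `1 < s < 2`, `β > 0`, and `A = {0, …, ⌊N/2⌋−1} ⊆ ZMod N`, there is a
constant `c = c(s,β) > 0`, independent of `N`, such that
`∑_{x ∈ A} ∑_{y ∉ A} (1 − exp(−β ‖x−y‖^(−s))) ≤ c · N^(2−s)` for every `N ≥ 3`. -/
theorem lrp_cut_expectation_bound (s β : ℝ) (hs1 : 1 < s) (hs2 : s < 2) (hβ : 0 < β) :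
    ∃ c : ℝ, 0 < c ∧
      ∀ (N : ℕ) [NeZero N], 3 ≤ N →
        ∑ x ∈ arcA N, ∑ y ∈ (arcA N)ᶜ,
            (1 - Real.exp (-β * (cycleDist N x y : ℝ) ^ (-s))) ≤
          c * (N : ℝ) ^ (2 - s) := by
  have hp : 0 < 2 - s := by linarith
  refine ⟨β * (2 / (2 - s)), by positivity, fun N _ _ => ?_⟩
  calc
    _ ≤ ∑ x ∈ arcA N, ∑ y ∈ (arcA N)ᶜ, β * (cycleDist N x y : ℝ) ^ (-s) := by
      refine Finset.sum_le_sum fun x _ => Finset.sum_le_sum fun y _ => ?_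
      linarith [Real.add_one_le_exp (-β * (cycleDist N x y : ℝ) ^ (-s))]
    _ = β * ∑ x ∈ arcA N, ∑ y ∈ (arcA N)ᶜ, (cycleDist N x y : ℝ) ^ (-s) := by
      simp_rw [Finset.mul_sum]
    _ ≤ β * (2 / (2 - s)) * (N : ℝ) ^ (2 - s) := by
      rw [mul_assoc]
      exact mul_le_mul_of_nonneg_left (sum_arcA_cycleDist_rpow_le hs1.le hs2 N) hβ.le
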